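/- arXiv:1801.09099 — 2 statements merged into one kernel-verified Lean document; each statement's English description precedes it below -/
import Mathlib

section
/- For all real numbers a, b, every integer n ≥ 0, and every real x: ((1+x)a − (1−x)(b+n+1))·P_n^{(a,b)}(x) − (1−x^2)·(d/dx)P_n^{(a,b)}(x) = 2(n+1)·P_{n+1}^{(a−1,b)}(x), and −n·P_n^{(a,b)}(x) + (1+x)·(d/dx)P_n^{(a,b)}(x) = (n+b)·P_{n−1}^{(a+1,b)}(x). -/
noncomputable section

/-- Generalized binomial coefficient `C(α, j) = α(α−1)⋯(α−j+1)/j!`. -/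
def genBinom (α : ℝ) (j : ℕ) : ℝ :=
  (∏ i ∈ Finset.range j, (α - i)) / (Nat.factorial j)

/-- Jacobi polynomial `P_n^{(a,b)}(x)`; zero for negative `n`. -/
def jacobiP (n : ℤ) (a b : ℝ) (x : ℝ) : ℝ :=
  if n < 0 then 0 else
    ∑ m ∈ Finset.range (n.toNat + 1),
      genBinom ((n : ℝ) + a) (n.toNat - m) * genBinom ((n : ℝ) + b) m *
        ((x - 1) / 2) ^ m * ((x + 1) / 2) ^ (n.toNat - m)

theorem succ_mul_genBinom_succ (α : ℝ) (j : ℕ) :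
    ((j : ℝ) + 1) * genBinom α (j + 1) = (α - j) * genBinom α j := by
  have h1 : ((j : ℝ) + 1) ≠ 0 := by positivity
  have h2 : (Nat.factorial j : ℝ) ≠ 0 := by positivity
  simp only [genBinom, Finset.prod_range_succ, Nat.factorial_succ]
  push_cast
  field_simp

theorem succ_mul_genBinom_add_one_succ (α : ℝ) (j : ℕ) :
    ((j : ℝ) + 1) * genBinom (α + 1) (j + 1) = (α + 1) * genBinom α j := by
  have h1 : ((j : ℝ) + 1) ≠ 0 := by positivity
  have h2 : (Nat.factorial j : ℝ) ≠ 0 := by positivity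
  simp only [genBinom, Finset.prod_range_succ', Nat.factorial_succ]
  push_cast
  simp only [add_sub_add_right_eq_sub, sub_zero]
  field_simp

theorem genBinom_add_one_succ (α : ℝ) (j : ℕ) :
    genBinom (α + 1) (j + 1) = genBinom α j + genBinom α (j + 1) := by
  have h1 : ((j : ℝ) + 1) ≠ 0 := by positivity
  apply mul_left_cancel₀ h1
  rw [mul_add, succ_mul_genBinom_add_one_succ, succ_mul_genBinom_succ]
  ring

theorem genBinom_zero (α : ℝ) : genBinom α 0 = 1 := by simp [genBinom]

theorem jacobiP_natCast (n : ℕ) (a b x : ℝ) :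
    jacobiP n a b x = ∑ m ∈ Finset.range (n + 1),
      genBinom ((n : ℝ) + a) (n - m) * genBinom ((n : ℝ) + b) m *
        ((x - 1) / 2) ^ m * ((x + 1) / 2) ^ (n - m) := by
  simp [jacobiP]

theorem hasDerivAt_jacobiP (n : ℕ) (a b x : ℝ) :
    HasDerivAt (jacobiP n a b) (∑ m ∈ Finset.range (n + 1),
      genBinom ((n : ℝ) + a) (n - m) * genBinom ((n : ℝ) + b) m *
        (m * ((x - 1) / 2) ^ (m - 1) * ((x + 1) / 2) ^ (n - m) +
          ((n - m : ℕ) : ℝ) * ((x - 1) / 2) ^ m * ((x + 1) / 2) ^ (n - m - 1)) / 2) x := by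
  have h : jacobiP n a b = fun y => ∑ m ∈ Finset.range (n + 1),
      genBinom ((n : ℝ) + a) (n - m) * genBinom ((n : ℝ) + b) m *
        ((y - 1) / 2) ^ m * ((y + 1) / 2) ^ (n - m) :=
    funext (jacobiP_natCast n a b)
  rw [h]
  refine HasDerivAt.fun_sum fun m _ => ?_
  have hv := (((hasDerivAt_id' x).sub_const 1).div_const 2).fun_pow m
  have hu := (((hasDerivAt_id' x).add_const 1).div_const 2).fun_pow (n - m)
  refine ((hv.const_mul
    (genBinom ((n : ℝ) + a) (n - m) * genBinom ((n : ℝ) + b) m)).fun_mul hu).congr_deriv ?_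
  ring

theorem natCast_mul_pow_sub_one_mul (m : ℕ) (y : ℝ) :
    (m : ℝ) * y ^ (m - 1) * y = m * y ^ m := by
  cases m with
  | zero => simp
  | succ k => rw [Nat.add_sub_cancel, pow_succ]; ring

theorem jacobiP_raise_degree (n : ℕ) (a b x : ℝ) :
    ((1 + x) * a - (1 - x) * (b + (n : ℝ) + 1)) * jacobiP n a b x
        - (1 - x ^ 2) * deriv (jacobiP n a b) x
      = 2 * ((n : ℝ) + 1) * jacobiP ((n + 1 : ℕ) : ℤ) (a - 1) b x := by
  rw [(hasDerivAt_jacobiP n a b x).deriv, jacobiP_natCast, jacobiP_natCast]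
  obtain ⟨v, rfl⟩ : ∃ v, x = 2 * v + 1 := ⟨(x - 1) / 2, by ring⟩
  have hv : (2 * v + 1 - 1) / 2 = v := by ring
  have hu : (2 * v + 1 + 1) / 2 = v + 1 := by ring
  have ha : ((n + 1 : ℕ) : ℝ) + (a - 1) = n + a := by push_cast; ring
  have hb : ((n + 1 : ℕ) : ℝ) + b = n + b + 1 := by push_cast; ring
  rw [hv, hu, ha, hb]
  generalize hw : v + 1 = u
  have hx : 1 + (2 * v + 1) = 2 * u := by rw [← hw]; ring
  have hx' : 1 - (2 * v + 1) ^ 2 = -4 * (u * v) := by rw [← hw]; ring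
  rw [hx, hx', show 1 - (2 * v + 1) = -2 * v by ring]
  have split : (2 * u * a - -2 * v * (b + (n : ℝ) + 1)) *
        (∑ m ∈ Finset.range (n + 1),
          genBinom ((n : ℝ) + a) (n - m) * genBinom ((n : ℝ) + b) m * v ^ m * u ^ (n - m))
      - -4 * (u * v) * (∑ m ∈ Finset.range (n + 1),
          genBinom ((n : ℝ) + a) (n - m) * genBinom ((n : ℝ) + b) m *
            (m * v ^ (m - 1) * u ^ (n - m) +
              ((n - m : ℕ) : ℝ) * v ^ m * u ^ (n - m - 1)) / 2)
      = 2 * (∑ m ∈ Finset.range (n + 1), ((n : ℝ) + 1 - m) *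
            genBinom ((n : ℝ) + a) (n + 1 - m) * genBinom ((n : ℝ) + b) m *
              v ^ m * u ^ (n + 1 - m))
        + 2 * (∑ m ∈ Finset.range (n + 1), (b + 2 * n + 1 - m) *
            genBinom ((n : ℝ) + a) (n - m) * genBinom ((n : ℝ) + b) m *
              v ^ (m + 1) * u ^ (n - m)) := by
    simp only [Finset.mul_sum]
    rw [← Finset.sum_sub_distrib, ← Finset.sum_add_distrib]
    refine Finset.sum_congr rfl fun m hm => ?_
    obtain ⟨j, rfl⟩ := Nat.exists_eq_add_of_le (Nat.lt_succ_iff.mp (Finset.mem_range.mp hm))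
    rw [show m + j - m = j by omega, show m + j + 1 - m = j + 1 by omega]
    have h1 := succ_mul_genBinom_succ (((m + j : ℕ) : ℝ) + a) j
    have h2 := natCast_mul_pow_sub_one_mul m v
    have h3 := natCast_mul_pow_sub_one_mul j u
    push_cast at h1 ⊢
    generalize genBinom ((m : ℝ) + j + a) (j + 1) = A' at *
    generalize genBinom ((m : ℝ) + j + a) j = A at *
    generalize genBinom ((m : ℝ) + j + b) m = B at *
    linear_combination (2 * A * B * u * u ^ j) * h2 + (2 * A * B * v * v ^ m) * h3
      - (2 * B * v ^ m * u ^ (j + 1)) * h1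
  have extend : ∑ m ∈ Finset.range (n + 1), ((n : ℝ) + 1 - m) *
        genBinom ((n : ℝ) + a) (n + 1 - m) * genBinom ((n : ℝ) + b) m *
          v ^ m * u ^ (n + 1 - m)
      = ∑ m ∈ Finset.range (n + 1 + 1), ((n : ℝ) + 1 - m) *
        genBinom ((n : ℝ) + a) (n + 1 - m) * genBinom ((n : ℝ) + b) m *
          v ^ m * u ^ (n + 1 - m) := by
    rw [Finset.sum_range_succ _ (n + 1)]
    simp
  rw [split, extend, Finset.sum_range_succ', Finset.sum_range_succ' _ (n + 1)]
  simp only [genBinom_zero, Nat.add_sub_add_right]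
  have key : (∑ m ∈ Finset.range (n + 1), ((n : ℝ) + 1 - (m + 1 : ℕ)) *
        genBinom ((n : ℝ) + a) (n - m) * genBinom ((n : ℝ) + b) (m + 1) *
          v ^ (m + 1) * u ^ (n - m))
      + ∑ m ∈ Finset.range (n + 1), (b + 2 * n + 1 - m) *
        genBinom ((n : ℝ) + a) (n - m) * genBinom ((n : ℝ) + b) m *
          v ^ (m + 1) * u ^ (n - m)
      = ((n : ℝ) + 1) * ∑ m ∈ Finset.range (n + 1),
        genBinom ((n : ℝ) + a) (n - m) * genBinom ((n : ℝ) + b + 1) (m + 1) *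
          v ^ (m + 1) * u ^ (n - m) := by
    rw [Finset.mul_sum, ← Finset.sum_add_distrib]
    refine Finset.sum_congr rfl fun m _ => ?_
    have h1 := succ_mul_genBinom_succ ((n : ℝ) + b) m
    rw [genBinom_add_one_succ]
    push_cast
    linear_combination -(genBinom ((n : ℝ) + a) (n - m) * v ^ (m + 1) * u ^ (n - m)) * h1
  push_cast at key ⊢
  linear_combination 2 * key

theorem jacobiP_lower_degree (n : ℕ) (a b x : ℝ) :
    -((n + 1 : ℕ) : ℝ) * jacobiP (n + 1 : ℕ) a b x
        + (1 + x) * deriv (jacobiP (n + 1 : ℕ) a b) x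
      = (((n + 1 : ℕ) : ℝ) + b) * jacobiP n (a + 1) b x := by
  rw [(hasDerivAt_jacobiP (n + 1) a b x).deriv, jacobiP_natCast, jacobiP_natCast]
  obtain ⟨v, rfl⟩ : ∃ v, x = 2 * v + 1 := ⟨(x - 1) / 2, by ring⟩
  have hv : (2 * v + 1 - 1) / 2 = v := by ring
  have hu : (2 * v + 1 + 1) / 2 = v + 1 := by ring
  have ha : ((n + 1 : ℕ) : ℝ) + a = n + (a + 1) := by push_cast; ring
  have hb : ((n + 1 : ℕ) : ℝ) + b = n + b + 1 := by push_cast; ring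
  rw [hv, hu, ha, hb]
  generalize hw : v + 1 = u
  rw [show 1 + (2 * v + 1) = 2 * u by rw [← hw]; ring]
  have collect : -((n + 1 : ℕ) : ℝ) * (∑ m ∈ Finset.range (n + 1 + 1),
          genBinom ((n : ℝ) + (a + 1)) (n + 1 - m) * genBinom ((n : ℝ) + b + 1) m *
            v ^ m * u ^ (n + 1 - m))
      + 2 * u * (∑ m ∈ Finset.range (n + 1 + 1),
          genBinom ((n : ℝ) + (a + 1)) (n + 1 - m) * genBinom ((n : ℝ) + b + 1) m *
            (m * v ^ (m - 1) * u ^ (n + 1 - m) +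
              ((n + 1 - m : ℕ) : ℝ) * v ^ m * u ^ (n + 1 - m - 1)) / 2)
      = ∑ m ∈ Finset.range (n + 1 + 1), m *
          genBinom ((n : ℝ) + (a + 1)) (n + 1 - m) * genBinom ((n : ℝ) + b + 1) m *
            v ^ (m - 1) * u ^ (n + 1 - m) := by
    simp only [Finset.mul_sum]
    rw [← Finset.sum_add_distrib]
    refine Finset.sum_congr rfl fun m hm => ?_
    have hle : m ≤ n + 1 := Nat.lt_succ_iff.mp (Finset.mem_range.mp hm)
    have hn : ((n + 1 : ℕ) : ℝ) = m + ((n + 1 - m : ℕ) : ℝ) := by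
      rw [Nat.cast_sub hle]; ring
    rw [hn]
    generalize n + 1 - m = j
    have h2 := natCast_mul_pow_sub_one_mul m v
    have h3 := natCast_mul_pow_sub_one_mul j u
    rw [← hw] at h3 ⊢
    linear_combination genBinom ((n : ℝ) + (a + 1)) j * genBinom ((n : ℝ) + b + 1) m *
      ((v + 1) ^ j * h2 + v ^ m * h3)
  rw [collect, Finset.sum_range_succ', Finset.mul_sum]
  simp only [Nat.add_sub_add_right, Nat.add_sub_cancel, Nat.cast_zero, zero_mul, add_zero]
  refine Finset.sum_congr rfl fun m _ => ?_
  have h1 := succ_mul_genBinom_add_one_succ ((n : ℝ) + b) m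
  push_cast
  linear_combination genBinom ((n : ℝ) + (a + 1)) (n - m) * v ^ m * u ^ (n - m) * h1

theorem jacobi_ladder_L4 (a b : ℝ) (n : ℤ) (hn : 0 ≤ n) (x : ℝ) :
    ((1 + x) * a - (1 - x) * (b + (n : ℝ) + 1)) * jacobiP n a b x
        - (1 - x ^ 2) * deriv (jacobiP n a b) x
      = 2 * ((n : ℝ) + 1) * jacobiP (n + 1) (a - 1) b x ∧
    -(n : ℝ) * jacobiP n a b x + (1 + x) * deriv (jacobiP n a b) x
      = ((n : ℝ) + b) * jacobiP (n - 1) (a + 1) b x := by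
  lift n to ℕ using hn
  refine ⟨by simpa using jacobiP_raise_degree n a b x, ?_⟩
  cases n with
  | zero =>
    rw [(hasDerivAt_jacobiP 0 a b x).deriv]
    simp [jacobiP]
  | succ k => simpa using jacobiP_lower_degree k a b x
end
end

section
/- Let a, b, c, d be real, let n ≥ k ≥ 0 be integers, and let (x,y) be real with x ≠ 1; write u(x,y) = P_{n,k}^{(a,b,c,d)}(x,y) and z = 1−x−y. Then: (yc − z(b+k+1))·u − yz·∂u/∂y = (k+1)·P_{n+1,k+1}^{(a,b,c−1,d−1)}(x,y); −(k/(1−x))·u + (y/(1−x))·∂u/∂y = (k+b)·P_{n−1,k−1}^{(a,b,c+1,d+1)}(x,y); (y(c+k+1) − zb)·u − yz·∂u/∂y = (k+1)·P_{n+1,k+1}^{(a,b−1,c,d−1)}(x,y); and (k/(1−x))·u + (1 − y/(1−x))·∂u/∂y = (k+c)·P_{n−1,k−1}^{(a,b+1,c,d+1)}(x,y). -/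
noncomputable section

/-- Four-parameter Koornwinder polynomial `P_{n,k}^{(a,b,c,d)}(x,y)`;
zero whenever `k < 0`, `n < 0`, or `k > n` (covering the conventions
`k = −1`, `n = −1`, `k = n+1`). -/
def koornP (n k : ℤ) (a b c d : ℝ) (x y : ℝ) : ℝ :=
  if n < 0 ∨ k < 0 ∨ n < k then 0 else
    jacobiP (n - k) (2 * (k : ℝ) + b + c + d + 1) a (2 * x - 1) *
      (1 - x) ^ k.toNat * jacobiP k c b (-1 + 2 * y / (1 - x))

theorem genBinom_succ_mul (α : ℝ) (j : ℕ) :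
    genBinom α (j + 1) * (j + 1) = genBinom α j * (α - j) := by
  have h : (j.factorial : ℝ) ≠ 0 := by positivity
  have h' : (j : ℝ) + 1 ≠ 0 := by positivity
  simp only [genBinom, Finset.prod_range_succ, Nat.factorial_succ]
  push_cast
  field_simp

theorem genBinom_add_one_succ_mul (α : ℝ) (j : ℕ) :
    genBinom (α + 1) (j + 1) * (j + 1) = (α + 1) * genBinom α j := by
  have h : (j.factorial : ℝ) ≠ 0 := by positivity
  have h' : (j : ℝ) + 1 ≠ 0 := by positivity
  simp only [genBinom, Finset.prod_range_succ', Nat.factorial_succ]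
  push_cast
  simp only [add_sub_add_right_eq_sub, sub_zero]
  field_simp

theorem genBinom_pascal (α : ℝ) (j : ℕ) :
    genBinom (α + 1) (j + 1) = genBinom α (j + 1) + genBinom α j := by
  have h' : (j : ℝ) + 1 ≠ 0 := by positivity
  apply mul_right_cancel₀ h'
  rw [add_mul, genBinom_add_one_succ_mul, genBinom_succ_mul]
  ring

/-- The homogeneous form of the Jacobi polynomial:
`w ^ k * P_k^{(c,b)}(-1 + 2 * p / w) = jacobiForm k c b p (p - w)`. -/
def jacobiForm (k : ℕ) (c b p q : ℝ) : ℝ :=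
  ∑ m ∈ Finset.HasAntidiagonal.antidiagonal k,
    genBinom (k + c) m.1 * genBinom (k + b) m.2 * (p ^ m.1 * q ^ m.2)

/-- The derivative of `jacobiForm k c b` along the direction `(1, 1)`. -/
def jacobiFormDeriv (k : ℕ) (c b p q : ℝ) : ℝ :=
  ∑ m ∈ Finset.HasAntidiagonal.antidiagonal k, genBinom (k + c) m.1 * genBinom (k + b) m.2 *
    ((m.1 * p ^ (m.1 - 1)) * q ^ m.2 + p ^ m.1 * (m.2 * q ^ (m.2 - 1)))

theorem jacobiForm_swap (k : ℕ) (c b p q : ℝ) :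
    jacobiForm k c b p q = jacobiForm k b c q p := by
  unfold jacobiForm
  rw [← Finset.Nat.sum_antidiagonal_swap]
  exact Finset.sum_congr rfl fun m _ => by simp only [Prod.fst_swap, Prod.snd_swap]; ring

theorem jacobiFormDeriv_swap (k : ℕ) (c b p q : ℝ) :
    jacobiFormDeriv k c b p q = jacobiFormDeriv k b c q p := by
  unfold jacobiFormDeriv
  rw [← Finset.Nat.sum_antidiagonal_swap]
  exact Finset.sum_congr rfl fun m _ => by simp only [Prod.fst_swap, Prod.snd_swap]; ring

theorem hasDerivAt_jacobiForm (k : ℕ) (c b w y : ℝ) :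
    HasDerivAt (fun t => jacobiForm k c b t (t - w)) (jacobiFormDeriv k c b y (y - w)) y := by
  unfold jacobiForm jacobiFormDeriv
  refine HasDerivAt.fun_sum fun m _ => ?_
  apply HasDerivAt.const_mul
  have h₁ : HasDerivAt (fun t : ℝ => t ^ m.1) (m.1 * y ^ (m.1 - 1)) y := hasDerivAt_pow _ _
  have h₂ : HasDerivAt (fun t : ℝ => (t - w) ^ m.2) (m.2 * (y - w) ^ (m.2 - 1)) y := by
    simpa using ((hasDerivAt_id y).sub_const w).fun_pow m.2
  exact h₁.mul h₂

theorem natCast_mul_pow_pred_mul (i : ℕ) (p : ℝ) : (i : ℝ) * p ^ (i - 1) * p = i * p ^ i := by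
  cases i with
  | zero => simp
  | succ i => rw [Nat.add_sub_cancel, pow_succ]; ring

theorem jacobiForm_raise (k : ℕ) (c b p q : ℝ) :
    (p * c + q * (b + k + 1)) * jacobiForm k c b p q + p * q * jacobiFormDeriv k c b p q
      = (k + 1) * jacobiForm (k + 1) (c - 1) b p q := by
  set F : ℕ × ℕ → ℝ := fun m =>
    m.1 * genBinom (k + c) m.1 * genBinom (k + b) m.2 * (p ^ m.1 * q ^ m.2) with hF
  set R : ℕ × ℕ → ℝ := fun m =>
    (k + 1) * (genBinom (k + c) m.1 * genBinom (k + b + 1) m.2 * (p ^ m.1 * q ^ m.2)) with hR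
  have hsumF : ∑ m ∈ Finset.HasAntidiagonal.antidiagonal (k + 1), F m
      = ∑ m ∈ Finset.HasAntidiagonal.antidiagonal k, F (m.1 + 1, m.2) := by
    rw [Finset.Nat.sum_antidiagonal_succ]
    simp [hF]
  have hsumG : ∑ m ∈ Finset.HasAntidiagonal.antidiagonal (k + 1), (R m - F m)
      = ∑ m ∈ Finset.HasAntidiagonal.antidiagonal k, (R (m.1, m.2 + 1) - F (m.1, m.2 + 1)) := by
    rw [Finset.Nat.sum_antidiagonal_succ']
    simp [hF, hR, genBinom_zero]
    ring
  have hrhs : (k + 1) * jacobiForm (k + 1) (c - 1) b p q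
      = ∑ m ∈ Finset.HasAntidiagonal.antidiagonal (k + 1), R m := by
    have h₁ : ((k + 1 : ℕ) : ℝ) + (c - 1) = k + c := by push_cast; ring
    have h₂ : ((k + 1 : ℕ) : ℝ) + b = k + b + 1 := by push_cast; ring
    rw [jacobiForm, h₁, h₂, Finset.mul_sum]
  have hsplit : ∑ m ∈ Finset.HasAntidiagonal.antidiagonal (k + 1), R m
      = ∑ m ∈ Finset.HasAntidiagonal.antidiagonal (k + 1), F m
        + ∑ m ∈ Finset.HasAntidiagonal.antidiagonal (k + 1), (R m - F m) := by
    rw [← Finset.sum_add_distrib]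
    exact Finset.sum_congr rfl fun m _ => by ring
  rw [hrhs, hsplit, hsumF, hsumG, jacobiForm, jacobiFormDeriv, Finset.mul_sum, Finset.mul_sum,
    ← Finset.sum_add_distrib, ← Finset.sum_add_distrib]
  refine Finset.sum_congr rfl fun m hm => ?_
  obtain ⟨i, j⟩ := m
  have hij : (i : ℝ) + j = k := by exact_mod_cast Finset.HasAntidiagonal.mem_antidiagonal.1 hm
  have h₁ := genBinom_succ_mul (k + c) i
  have h₂ := genBinom_succ_mul (k + b) j
  have hp := natCast_mul_pow_pred_mul i p
  have hq := natCast_mul_pow_pred_mul j q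
  simp only [hF, hR, genBinom_pascal, pow_succ]
  push_cast
  set A := genBinom (k + c) i
  set B := genBinom (k + b) j
  set A' := genBinom (k + c) (i + 1)
  set B' := genBinom (k + b) (j + 1)
  rw [← hij] at h₁ h₂ ⊢
  linear_combination (A * B * q ^ j * q) * hp + (A * B * p ^ i * p) * hq
    - (B * p ^ i * p * q ^ j) * h₁ - (A * p ^ i * q ^ j * q) * h₂

theorem jacobiForm_raise' (k : ℕ) (c b p q : ℝ) :
    (p * (c + k + 1) + q * b) * jacobiForm k c b p q + p * q * jacobiFormDeriv k c b p q
      = (k + 1) * jacobiForm (k + 1) c (b - 1) p q := by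
  rw [jacobiForm_swap k, jacobiFormDeriv_swap, jacobiForm_swap (k + 1), ← jacobiForm_raise]
  ring

theorem jacobiForm_lower (k : ℕ) (c b p q : ℝ) :
    p * jacobiFormDeriv (k + 1) c b p q - (k + 1) * jacobiForm (k + 1) c b p q
      = (p - q) * ((k + 1 + b) * jacobiForm k (c + 1) b p q) := by
  have h₁ : ((k + 1 : ℕ) : ℝ) + c = k + (c + 1) := by push_cast; ring
  have h₂ : ((k + 1 : ℕ) : ℝ) + b = k + b + 1 := by push_cast; ring
  have hlhs : p * jacobiFormDeriv (k + 1) c b p q - (k + 1) * jacobiForm (k + 1) c b p q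
      = ∑ m ∈ Finset.HasAntidiagonal.antidiagonal (k + 1), genBinom (k + (c + 1)) m.1 *
          (genBinom (k + b + 1) m.2 * m.2) * (p ^ m.1 * (p * q ^ (m.2 - 1) - q ^ m.2)) := by
    rw [jacobiForm, jacobiFormDeriv, h₁, h₂, Finset.mul_sum, Finset.mul_sum,
      ← Finset.sum_sub_distrib]
    refine Finset.sum_congr rfl fun m hm => ?_
    have hij : (m.1 : ℝ) + m.2 = k + 1 := by exact_mod_cast Finset.HasAntidiagonal.mem_antidiagonal.1 hm
    have hp := natCast_mul_pow_pred_mul m.1 p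
    rw [← hij]
    linear_combination
      (genBinom (k + (c + 1)) m.1 * genBinom (k + b + 1) m.2 * q ^ m.2) * hp
  rw [hlhs, Finset.Nat.sum_antidiagonal_succ', jacobiForm, Finset.mul_sum, Finset.mul_sum]
  simp only [Nat.cast_zero, mul_zero, zero_mul, zero_add]
  refine Finset.sum_congr rfl fun m _ => ?_
  push_cast
  rw [genBinom_add_one_succ_mul, pow_succ]
  ring

theorem jacobiForm_lower' (k : ℕ) (c b p q : ℝ) :
    (k + 1) * jacobiForm (k + 1) c b p q - q * jacobiFormDeriv (k + 1) c b p q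
      = (p - q) * ((k + 1 + c) * jacobiForm k c (b + 1) p q) := by
  rw [jacobiForm_swap (k + 1), jacobiFormDeriv_swap, jacobiForm_swap k]
  linear_combination -jacobiForm_lower k b c q p

theorem pow_mul_jacobiP (k : ℕ) (c b w y : ℝ) (hw : w ≠ 0) :
    w ^ k * jacobiP k c b (-1 + 2 * y / w) = jacobiForm k c b y (y - w) := by
  have h₁ : (-1 + 2 * y / w + 1) / 2 = y / w := by ring
  have h₂ : (-1 + 2 * y / w - 1) / 2 = (y - w) / w := by field_simp; ring
  rw [jacobiP, if_neg (by simp), h₁, h₂, jacobiForm_swap, jacobiForm,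
    Finset.Nat.sum_antidiagonal_eq_sum_range_succ_mk, Finset.mul_sum, Int.toNat_natCast]
  refine Finset.sum_congr rfl fun m hm => ?_
  have hm' : m ≤ k := Nat.lt_succ_iff.1 (Finset.mem_range.1 hm)
  have hpow : w ^ k = w ^ m * w ^ (k - m) := by rw [← pow_add, Nat.add_sub_cancel' hm']
  rw [hpow, div_pow, div_pow, Int.cast_natCast]
  field_simp

theorem koornP_eq_jacobiForm (n : ℤ) (k : ℕ) (hnk : (k : ℤ) ≤ n) (a b c d x y : ℝ)
    (hx : x ≠ 1) :
    koornP n k a b c d x y = jacobiP (n - k) (2 * (k : ℝ) + b + c + d + 1) a (2 * x - 1) *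
      jacobiForm k c b y (y - (1 - x)) := by
  rw [koornP, if_neg (by omega), mul_assoc, Int.toNat_natCast,
    pow_mul_jacobiP k c b (1 - x) y (sub_ne_zero.2 hx.symm), Int.cast_natCast]

theorem deriv_koornP (n : ℤ) (k : ℕ) (hnk : (k : ℤ) ≤ n) (a b c d x y : ℝ) (hx : x ≠ 1) :
    deriv (koornP n k a b c d x) y
      = jacobiP (n - k) (2 * (k : ℝ) + b + c + d + 1) a (2 * x - 1) *
        jacobiFormDeriv k c b y (y - (1 - x)) := by
  rw [funext fun t => koornP_eq_jacobiForm n k hnk a b c d x t hx]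
  exact ((hasDerivAt_jacobiForm k c b (1 - x) y).const_mul _).deriv

theorem koornP_add_one (n : ℤ) (k : ℕ) (hnk : (k : ℤ) ≤ n) (a b c d x y b' c' d' : ℝ)
    (hx : x ≠ 1) (h : b' + c' + d' + 2 = b + c + d) :
    koornP (n + 1) (k + 1) a b' c' d' x y
      = jacobiP (n - k) (2 * (k : ℝ) + b + c + d + 1) a (2 * x - 1) *
        jacobiForm (k + 1) c' b' y (y - (1 - x)) := by
  have hn : n + 1 - ((k + 1 : ℕ) : ℤ) = n - k := by push_cast; ring
  have ha : 2 * ((k + 1 : ℕ) : ℝ) + b' + c' + d' + 1 = 2 * (k : ℝ) + b + c + d + 1 := by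
    push_cast; linear_combination h
  rw [← Nat.cast_succ, koornP_eq_jacobiForm (n + 1) (k + 1) (by push_cast; omega) _ _ _ _ _ _ hx,
    hn, ha]

theorem koornP_sub_one (n : ℤ) (k : ℕ) (hnk : ((k + 1 : ℕ) : ℤ) ≤ n)
    (a b c d x y b' c' d' : ℝ) (hx : x ≠ 1) (h : b' + c' + d' = b + c + d + 2) :
    koornP (n - 1) (((k + 1 : ℕ) : ℤ) - 1) a b' c' d' x y
      = jacobiP (n - (k + 1 : ℕ)) (2 * ((k + 1 : ℕ) : ℝ) + b + c + d + 1) a (2 * x - 1) *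
        jacobiForm k c' b' y (y - (1 - x)) := by
  have hk : ((k + 1 : ℕ) : ℤ) - 1 = k := by push_cast; ring
  have hn : n - 1 - (k : ℤ) = n - (k + 1 : ℕ) := by push_cast; ring
  have ha : 2 * (k : ℝ) + b' + c' + d' + 1 = 2 * ((k + 1 : ℕ) : ℝ) + b + c + d + 1 := by
    push_cast; linear_combination h
  rw [hk, koornP_eq_jacobiForm (n - 1) k (by push_cast at hnk; omega) _ _ _ _ _ _ hx, hn, ha]

theorem koorn_ladder_M04_M05 (a b c d : ℝ) (n k : ℤ) (hk : 0 ≤ k) (hnk : k ≤ n)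
    (x y : ℝ) (hx : x ≠ 1) :
    ((y * c - (1 - x - y) * (b + (k : ℝ) + 1)) * koornP n k a b c d x y
        - y * (1 - x - y) * deriv (koornP n k a b c d x) y
      = ((k : ℝ) + 1) * koornP (n + 1) (k + 1) a b (c - 1) (d - 1) x y) ∧
    (-((k : ℝ) / (1 - x)) * koornP n k a b c d x y
        + (y / (1 - x)) * deriv (koornP n k a b c d x) y
      = ((k : ℝ) + b) * koornP (n - 1) (k - 1) a b (c + 1) (d + 1) x y) ∧
    ((y * (c + (k : ℝ) + 1) - (1 - x - y) * b) * koornP n k a b c d x y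
        - y * (1 - x - y) * deriv (koornP n k a b c d x) y
      = ((k : ℝ) + 1) * koornP (n + 1) (k + 1) a (b - 1) c (d - 1) x y) ∧
    (((k : ℝ) / (1 - x)) * koornP n k a b c d x y
        + (1 - y / (1 - x)) * deriv (koornP n k a b c d x) y
      = ((k : ℝ) + c) * koornP (n - 1) (k - 1) a (b + 1) c (d + 1) x y) := by
  lift k to ℕ using hk
  have hw : 1 - x ≠ 0 := sub_ne_zero.2 hx.symm
  simp only [Int.cast_natCast]
  rw [koornP_eq_jacobiForm n k hnk a b c d x y hx, deriv_koornP n k hnk a b c d x y hx,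
    koornP_add_one n k hnk a b c d x y b (c - 1) (d - 1) hx (by ring),
    koornP_add_one n k hnk a b c d x y (b - 1) c (d - 1) hx (by ring)]
  set J := jacobiP (n - k) (2 * (k : ℝ) + b + c + d + 1) a (2 * x - 1) with hJ
  refine ⟨?_, ?_, ?_, ?_⟩
  · linear_combination J * jacobiForm_raise k c b y (y - (1 - x))
  · cases k with
    | zero => simp [koornP, jacobiFormDeriv]
    | succ k =>
      rw [koornP_sub_one n k hnk a b c d x y b (c + 1) (d + 1) hx (by ring), ← hJ]
      have h := jacobiForm_lower k c b y (y - (1 - x))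
      field_simp
      push_cast
      linear_combination J * h
  · linear_combination J * jacobiForm_raise' k c b y (y - (1 - x))
  · cases k with
    | zero => simp [koornP, jacobiFormDeriv]
    | succ k =>
      rw [koornP_sub_one n k hnk a b c d x y (b + 1) c (d + 1) hx (by ring), ← hJ]
      have h := jacobiForm_lower' k c b y (y - (1 - x))
      field_simp
      push_cast
      linear_combination J * h
end
end
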